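/- arXiv:1601.01626 — 7 statements merged into one kernel-verified Lean document; each statement's English description precedes it below -/
import Mathlib

section
/- The biharmonic plane contains no zero divisors of 𝔹: for all real numbers x, y with (x, y) ≠ (0, 0), the element ζ = x·e1 + y·e2 = x·1 + y·(i + ε) of the dual numbers over ℂ is a unit, i.e. there exists ζ⁻¹ ∈ 𝔹 with ζ·ζ⁻¹ = 1. -/
/- The biharmonic algebra 𝔹 is the dual numbers over ℂ, with biharmonic basis
   e1 = 1, e2 = i + ε.  The biharmonic plane is μ = {x·e1 + y·e2 : x, y ∈ ℝ}. -/

open TrivSqZeroExt DualNumber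

noncomputable section

/-- The basis element `e₂ = i + ε` of the biharmonic algebra `𝔹 = ℂ[ε]`. -/
def e₂ : DualNumber ℂ := inl Complex.I + eps

/-- The point `ζ = x·e1 + y·e2` of the biharmonic plane `μ ⊂ 𝔹`. -/
def ζm (x y : ℝ) : DualNumber ℂ := inl (x : ℂ) * 1 + inl (y : ℂ) * e₂

/-- The biharmonic plane contains no zero divisors of `𝔹`: for all real `x, y` with
`(x, y) ≠ (0, 0)`, the element `ζ = x·e1 + y·e2` is invertible in `𝔹`. -/
theorem biharmonic_plane_no_zero_divisors (x y : ℝ) (hxy : (x, y) ≠ (0, 0)) :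
    ∃ ζinv : DualNumber ℂ, ζm x y * ζinv = 1 := by
  refine (isUnit_iff_isUnit_fst.mpr (isUnit_iff_ne_zero.mpr fun h => hxy ?_)).exists_right_inv
  have hre := congrArg Complex.re h
  have him := congrArg Complex.im h
  simp [ζm, e₂] at hre him
  simp [hre, him]
end
end

section
/- Uniqueness of the biharmonic algebra (Mel'nichenko): every two-dimensional commutative associative unital algebra A over ℂ that possesses a biharmonic basis — i.e. elements e1, e2 forming a ℂ-basis of A with (e1² + e2²)² = 0 and e1² + e2² ≠ 0 — is isomorphic as a ℂ-algebra to the algebra of dual numbers over ℂ. -/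
/- Mel'nichenko's uniqueness theorem: every two-dimensional commutative associative
   unital algebra over ℂ possessing a biharmonic basis is isomorphic, as a
   ℂ-algebra, to the dual numbers over ℂ. -/

noncomputable section

/-- A two-dimensional commutative algebra over a field containing a nonzero element of square
zero is isomorphic to the dual numbers. -/
theorem nonempty_algEquiv_dualNumber {K A : Type*} [Field K] [CommRing A] [Algebra K A]
    (hA : Module.finrank K A = 2) {n : A} (hn : n ≠ 0) (hn2 : n ^ 2 = 0) :
    Nonempty (A ≃ₐ[K] DualNumber K) := by
  have hnn : n * n = 0 := by rw [← sq, hn2]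
  let f : DualNumber K →ₐ[K] A :=
    DualNumber.lift ⟨(Algebra.ofId K A, n), hnn, fun _ => Commute.all _ _⟩
  have hf (x : DualNumber K) : f x = algebraMap K A x.fst + algebraMap K A x.snd * n := rfl
  have hsmul {c : K} (hc : algebraMap K A c * n = 0) : c = 0 := by
    rw [← Algebra.smul_def] at hc
    exact (smul_eq_zero.mp hc).resolve_right hn
  have hinj : Function.Injective f := by
    refine (injective_iff_map_eq_zero f).mpr fun x hx => ?_
    rw [hf] at hx
    have hfst : x.fst = 0 := hsmul (by linear_combination n * hx - algebraMap K A x.snd * hnn)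
    rw [hfst, map_zero, zero_add] at hx
    exact TrivSqZeroExt.ext hfst (hsmul hx)
  have hD : Module.finrank K (DualNumber K) = 2 := by
    change Module.finrank K (K × K) = 2
    simp
  have : FiniteDimensional K A := .of_finrank_eq_succ hA
  have : FiniteDimensional K (DualNumber K) := .of_finrank_eq_succ hD
  have hsurj : Function.Surjective f :=
    (LinearMap.injective_iff_surjective_of_finrank_eq_finrank (f := f.toLinearMap)
      (hD.trans hA.symm)).mp hinj
  exact ⟨(AlgEquiv.ofBijective f ⟨hinj, hsurj⟩).symm⟩

/-- Uniqueness of the biharmonic algebra (Mel'nichenko): if a commutative associative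
unital ℂ-algebra `A` has a ℂ-basis `{e₁, e₂}` (so `A` is two-dimensional) with
`(e₁² + e₂²)² = 0` and `e₁² + e₂² ≠ 0`, then `A` is isomorphic as a ℂ-algebra to the
algebra of dual numbers over `ℂ`. -/
theorem biharmonic_algebra_unique (A : Type*) [CommRing A] [Algebra ℂ A]
    (e₁ e₂ : A)
    (hind : LinearIndependent ℂ ![e₁, e₂])
    (hspan : Submodule.span ℂ {e₁, e₂} = ⊤)
    (hbih₁ : (e₁ ^ 2 + e₂ ^ 2) ^ 2 = 0)
    (hbih₂ : e₁ ^ 2 + e₂ ^ 2 ≠ 0) :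
    Nonempty (A ≃ₐ[ℂ] DualNumber ℂ) := by
  have hfinrank : Module.finrank ℂ A = 2 := by
    simpa using Module.finrank_eq_card_basis
      (Module.Basis.mk hind (by simp [Set.pair_comm e₂, hspan]))
  exact nonempty_algEquiv_dualNumber hfinrank hbih₂ hbih₁
end
end

section
/- Characterization of monogenic functions (Kovalev–Mel'nichenko): let D be an open set in ℝ², D_ζ = {x·e1 + y·e2 : (x,y) ∈ D} ⊂ μ, and Φ : D_ζ → 𝔹 with component functions U₁, U₂, U₃, U₄ : D → ℝ given by Φ(x·e1 + y·e2) = U₁(x,y)·e1 + U₂(x,y)·i·e1 + U₃(x,y)·e2 + U₄(x,y)·i·e2. Then Φ is monogenic in D_ζ — i.e. for every ζ ∈ D_ζ there exists Φ'(ζ) ∈ 𝔹 such that (Φ(ζ+h) − Φ(ζ))·h⁻¹ tends to Φ'(ζ) as h → 0 with h ranging over nonzero elements of the plane μ — if and only if U₁, U₂, U₃, U₄ are (totally) differentiable in D and satisfy at every point of D the Cauchy–Riemann-type system: ∂U₁/∂y = ∂U₃/∂x; ∂U₂/∂y = ∂U₄/∂x; ∂U₃/∂y = ∂U₁/∂x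 − 2·∂U₄/∂x; ∂U₄/∂y = ∂U₂/∂x + 2·∂U₃/∂x. -/
/- Characterization of monogenic functions (Kovalev–Mel'nichenko).
   𝔹 = dual numbers over ℂ, e1 = 1, e2 = i + ε; the biharmonic plane is
   μ = {x·e1 + y·e2 : x, y ∈ ℝ}; nonzero elements of μ are invertible in 𝔹. -/

open TrivSqZeroExt DualNumber Filter Topology

noncomputable section

/-- The biharmonic plane `μ = {x·e1 + y·e2 : x, y ∈ ℝ} ⊂ 𝔹`. -/
def biplane : Set (DualNumber ℂ) := {h | ∃ x y : ℝ, h = ζm x y}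

/-- The element `U₁·e1 + U₂·i·e1 + U₃·e2 + U₄·i·e2` of `𝔹`. -/
def rep (a b c d : ℝ) : DualNumber ℂ :=
  inl (a : ℂ) * 1 + inl (b : ℂ) * inl Complex.I * 1
    + inl (c : ℂ) * e₂ + inl (d : ℂ) * inl Complex.I * e₂

/-- `Φ` is monogenic at `ζ₀`: there exists `Φ'(ζ₀) ∈ 𝔹` such that
`(Φ(ζ₀+h) − Φ(ζ₀))·h⁻¹ → Φ'(ζ₀)` as `h → 0` over nonzero elements `h` of the
biharmonic plane. -/
def MonogenicAt (Φ : DualNumber ℂ → DualNumber ℂ) (ζ₀ : DualNumber ℂ) : Prop :=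
  ∃ d : DualNumber ℂ,
    Tendsto (fun h => (Φ (ζ₀ + h) - Φ ζ₀) * Ring.inverse h)
      (𝓝[{h | h ∈ biplane ∧ h ≠ 0}] 0) (𝓝 d)

/-- The partial derivative in `x` of a function `ℝ² → ℝ`. -/
def pdx (f : ℝ × ℝ → ℝ) : ℝ × ℝ → ℝ := fun p => fderiv ℝ f p (1, 0)

/-- The partial derivative in `y` of a function `ℝ² → ℝ`. -/
def pdy (f : ℝ × ℝ → ℝ) : ℝ × ℝ → ℝ := fun p => fderiv ℝ f p (0, 1)

/-- The Cauchy–Riemann-type system for the components `U₁, U₂, U₃, U₄`. -/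
def CRsys (U₁ U₂ U₃ U₄ : ℝ × ℝ → ℝ) (p : ℝ × ℝ) : Prop :=
  pdy U₁ p = pdx U₃ p ∧
  pdy U₂ p = pdx U₄ p ∧
  pdy U₃ p = pdx U₁ p - 2 * pdx U₄ p ∧
  pdy U₄ p = pdx U₂ p + 2 * pdx U₃ p

/-- The complex coordinate `x + i·y` on `ℝ × ℝ`, as a real-linear map. -/
def complexCoord : ℝ × ℝ →L[ℝ] ℂ :=
  Complex.equivRealProdCLM.symm

theorem complexCoord_apply (v : ℝ × ℝ) : complexCoord v = v.1 + v.2 * Complex.I :=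
  Complex.equivRealProdCLM_symm_apply v

theorem complexCoord_eq_zero {v : ℝ × ℝ} : complexCoord v = 0 ↔ v = 0 :=
  Complex.equivRealProdCLM.symm.map_eq_zero_iff

theorem norm_snd_div_complexCoord_le (v : ℝ × ℝ) : ‖(v.2 : ℂ) / complexCoord v‖ ≤ 1 := by
  rw [norm_div, Complex.norm_real]
  refine div_le_one_of_le₀ ?_ (norm_nonneg _)
  simpa [complexCoord_apply] using Complex.abs_im_le_norm (complexCoord v)

theorem fst_ζm (x y : ℝ) : (ζm x y).fst = complexCoord (x, y) := by
  simp [ζm, e₂, complexCoord_apply]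

theorem snd_ζm (x y : ℝ) : (ζm x y).snd = y := by
  simp [ζm, e₂]

theorem fst_rep (a b c d : ℝ) : (rep a b c d).fst = (a - d : ℝ) + (b + c : ℝ) * Complex.I := by
  apply Complex.ext <;> simp [rep, e₂]
  ring

theorem snd_rep (a b c d : ℝ) : (rep a b c d).snd = c + d * Complex.I := by
  simp [rep, e₂]

theorem ζm_add (p v : ℝ × ℝ) : ζm p.1 p.2 + ζm v.1 v.2 = ζm (p + v).1 (p + v).2 := by
  ext <;> simp [fst_ζm, snd_ζm, complexCoord_apply]
  ring

theorem isEmbedding_ζm : IsEmbedding fun v : ℝ × ℝ => ζm v.1 v.2 := by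
  refine Function.LeftInverse.isEmbedding
    (f := fun h : DualNumber ℂ => (h.fst.re, h.fst.im)) ?_ ?_ ?_
  · intro v
    simp [fst_ζm, complexCoord_apply]
  · exact (Complex.continuous_re.comp TrivSqZeroExt.continuous_fst).prodMk
      (Complex.continuous_im.comp TrivSqZeroExt.continuous_fst)
  · unfold ζm
    have h : Continuous (inl : ℂ → DualNumber ℂ) := TrivSqZeroExt.continuous_inl
    fun_prop

theorem map_ζm_nhdsNE_zero :
    map (fun v : ℝ × ℝ => ζm v.1 v.2) (𝓝[≠] 0) = 𝓝[{h | h ∈ biplane ∧ h ≠ 0}] 0 := by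
  have h0 : ζm 0 0 = 0 := by ext <;> simp [fst_ζm, snd_ζm, complexCoord_apply]
  rw [isEmbedding_ζm.map_nhdsWithin_eq]
  have hs : (fun v : ℝ × ℝ => ζm v.1 v.2) '' {0}ᶜ = {h | h ∈ biplane ∧ h ≠ 0} := by
    ext h
    constructor
    · rintro ⟨v, hv, rfl⟩
      refine ⟨⟨v.1, v.2, rfl⟩, fun h => hv ?_⟩
      exact isEmbedding_ζm.injective (h.trans h0.symm)
    · rintro ⟨⟨x, y, rfl⟩, hne⟩
      refine ⟨(x, y), fun h => hne ?_, rfl⟩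
      obtain ⟨rfl, rfl⟩ := Prod.mk.inj h
      exact h0
  rw [hs]
  simp [h0]

theorem inverse_ζm {v : ℝ × ℝ} (hv : v ≠ 0) :
    Ring.inverse (ζm v.1 v.2) =
      inl (complexCoord v)⁻¹ + inr (-(v.2 / complexCoord v ^ 2)) := by
  have hz : complexCoord v ≠ 0 := complexCoord_eq_zero.not.2 hv
  have h : ζm v.1 v.2 * (inl (complexCoord v)⁻¹ + inr (-(v.2 / complexCoord v ^ 2))) = 1 := by
    ext
    · simp [fst_ζm, hz]
    · simp [fst_ζm, snd_ζm]
      field_simp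
      ring
  exact Ring.inverse_unit ⟨_, _, h, (mul_comm _ _).trans h⟩

theorem hasFDerivAt_iff_tendsto_div_complexCoord {G : ℝ × ℝ → ℂ} {L : ℝ × ℝ →L[ℝ] ℂ}
    {p : ℝ × ℝ} :
    HasFDerivAt G L p ↔
      Tendsto (fun v => (G (p + v) - G p - L v) / complexCoord v) (𝓝[≠] 0) (𝓝 0) := by
  have hΘ : (fun v : ℝ × ℝ => complexCoord v) =Θ[𝓝 0] fun v => v :=
    ⟨complexCoord.isBigO_id _, Complex.equivRealProdCLM.symm.isBigO_comp_rev (fun v => v) _⟩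
  rw [hasFDerivAt_iff_isLittleO_nhds_zero, ← hΘ.isLittleO_congr_right,
    Asymptotics.isLittleO_iff_tendsto]
  · have := continuousWithinAt_compl_self
      (f := fun v => (G (p + v) - G p - L v) / complexCoord v) (x := (0 : ℝ × ℝ))
    simpa [ContinuousWithinAt, ContinuousAt] using this.symm
  · intro v hv
    simp [complexCoord_eq_zero.1 hv]

theorem tendsto_nhds_iff_fst_snd {α : Type*} {l : Filter α} {f : α → DualNumber ℂ}
    {d : DualNumber ℂ} :
    Tendsto f l (𝓝 d) ↔
      Tendsto (fun a => (f a).fst) l (𝓝 d.fst) ∧ Tendsto (fun a => (f a).snd) l (𝓝 d.snd) := by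
  rw [TrivSqZeroExt.nhds_def]
  exact tendsto_prod_iff'

/-- Existence of the monogenic derivative `d`, in terms of the real derivatives of the two
complex components of `Φ`. -/
theorem tendsto_iff_hasFDerivAt {Φ : DualNumber ℂ → DualNumber ℂ} {F S : ℝ × ℝ → ℂ}
    {p : ℝ × ℝ} (hF : ∀ᶠ q in 𝓝 p, (Φ (ζm q.1 q.2)).fst = F q)
    (hS : ∀ᶠ q in 𝓝 p, (Φ (ζm q.1 q.2)).snd = S q) (d : DualNumber ℂ) :
    Tendsto (fun h => (Φ (ζm p.1 p.2 + h) - Φ (ζm p.1 p.2)) * Ring.inverse h)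
      (𝓝[{h | h ∈ biplane ∧ h ≠ 0}] 0) (𝓝 d) ↔
    HasFDerivAt F (d.fst • complexCoord) p ∧
      HasFDerivAt S (d.snd • complexCoord +
        d.fst • Complex.ofRealCLM.comp (ContinuousLinearMap.snd ℝ ℝ ℝ)) p := by
  have hadd : Tendsto (fun v => p + v) (𝓝[≠] 0) (𝓝 p) := by
    have : Tendsto (fun v => p + v) (𝓝 0) (𝓝 (p + 0)) := (continuous_const_add p).tendsto 0
    rw [add_zero] at this
    exact this.mono_left nhdsWithin_le_nhds
  rw [← map_ζm_nhdsNE_zero, tendsto_map'_iff, tendsto_nhds_iff_fst_snd,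
    hasFDerivAt_iff_tendsto_div_complexCoord, hasFDerivAt_iff_tendsto_div_complexCoord]
  set A : ℝ × ℝ → ℂ := fun v => (F (p + v) - F p - (d.fst • complexCoord) v) / complexCoord v
  set B : ℝ × ℝ → ℂ := fun v => (S (p + v) - S p - (d.snd • complexCoord +
    d.fst • Complex.ofRealCLM.comp (ContinuousLinearMap.snd ℝ ℝ ℝ)) v) / complexCoord v
  have hfst : Tendsto (fun v : ℝ × ℝ => ((Φ (ζm p.1 p.2 + ζm v.1 v.2) - Φ (ζm p.1 p.2)) *
      Ring.inverse (ζm v.1 v.2)).fst) (𝓝[≠] 0) (𝓝 d.fst) ↔ Tendsto A (𝓝[≠] 0) (𝓝 0) := by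
    rw [← tendsto_sub_nhds_zero_iff]
    refine tendsto_congr' ?_
    filter_upwards [hadd.eventually hF, self_mem_nhdsWithin] with v hv hv0
    have hz : complexCoord v ≠ 0 := complexCoord_eq_zero.not.2 hv0
    rw [inverse_ζm hv0, ζm_add]
    simp only [fst_mul, fst_sub, fst_add, fst_inl, fst_inr, hv, hF.self_of_nhds, A,
      _root_.smul_apply, smul_eq_mul]
    field_simp
    ring
  have hsnd : Tendsto (fun v : ℝ × ℝ => ((Φ (ζm p.1 p.2 + ζm v.1 v.2) - Φ (ζm p.1 p.2)) *
      Ring.inverse (ζm v.1 v.2)).snd) (𝓝[≠] 0) (𝓝 d.snd) ↔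
      Tendsto (fun v => B v - v.2 / complexCoord v * A v) (𝓝[≠] 0) (𝓝 0) := by
    rw [← tendsto_sub_nhds_zero_iff]
    refine tendsto_congr' ?_
    filter_upwards [hadd.eventually hF, hadd.eventually hS, self_mem_nhdsWithin] with v hv hv' hv0
    have hz : complexCoord v ≠ 0 := complexCoord_eq_zero.not.2 hv0
    rw [inverse_ζm hv0, ζm_add]
    simp only [DualNumber.snd_mul, fst_sub, snd_sub, fst_add, snd_add, fst_inl, fst_inr,
      snd_inl, snd_inr, hv, hv', hF.self_of_nhds, hS.self_of_nhds, A, B, _root_.smul_apply,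
      _root_.add_apply, ContinuousLinearMap.comp_apply, Complex.ofRealCLM_apply,
      ContinuousLinearMap.coe_snd', smul_eq_mul]
    field_simp
    ring
  refine (and_congr hfst hsnd).trans (and_congr_right fun hA => ?_)
  have hyA : Tendsto (fun v : ℝ × ℝ => v.2 / complexCoord v * A v) (𝓝[≠] 0) (𝓝 0) :=
    isBoundedUnder_le_mul_tendsto_zero
      (isBoundedUnder_of ⟨1, norm_snd_div_complexCoord_le⟩) hA
  exact ⟨fun h => by simpa using h.add hyA, fun h => by simpa using h.sub hyA⟩

/-- Kovalev–Mel'nichenko characterization: `Φ` with components `U₁, U₂, U₃, U₄` is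
monogenic in `D_ζ` if and only if `U₁, U₂, U₃, U₄` are totally differentiable in `D`
and satisfy the Cauchy–Riemann-type system at every point of `D`. -/
theorem monogenic_iff_CR (D : Set (ℝ × ℝ)) (hD : IsOpen D)
    (U₁ U₂ U₃ U₄ : ℝ × ℝ → ℝ) (Φ : DualNumber ℂ → DualNumber ℂ)
    (hΦ : ∀ p ∈ D, Φ (ζm p.1 p.2) = rep (U₁ p) (U₂ p) (U₃ p) (U₄ p)) :
    (∀ p ∈ D, MonogenicAt Φ (ζm p.1 p.2)) ↔
      (∀ p ∈ D,
        (DifferentiableAt ℝ U₁ p ∧ DifferentiableAt ℝ U₂ p ∧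
         DifferentiableAt ℝ U₃ p ∧ DifferentiableAt ℝ U₄ p) ∧
        CRsys U₁ U₂ U₃ U₄ p) := by
  have key : ∀ p ∈ D, ∀ d : DualNumber ℂ, _ := fun p hp d =>
    tendsto_iff_hasFDerivAt (Φ := Φ) (p := p)
      (F := fun q => (U₁ q - U₄ q : ℝ) + (U₂ q + U₃ q : ℝ) * Complex.I)
      (S := fun q => U₃ q + U₄ q * Complex.I)
      (by filter_upwards [hD.mem_nhds hp] with q hq; rw [hΦ q hq, fst_rep])
      (by filter_upwards [hD.mem_nhds hp] with q hq; rw [hΦ q hq, snd_rep]) d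
  refine forall₂_congr fun p hp => ⟨?_, ?_⟩
  · rintro ⟨d, hd⟩
    obtain ⟨hF, hS⟩ := (key p hp d).1 hd
    have h3 : HasFDerivAt U₃ _ p :=
      (Complex.reCLM.hasFDerivAt.comp p hS).congr_of_eventuallyEq (.of_forall fun q => by simp)
    have h4 : HasFDerivAt U₄ _ p :=
      (Complex.imCLM.hasFDerivAt.comp p hS).congr_of_eventuallyEq (.of_forall fun q => by simp)
    have h14 : HasFDerivAt (fun q => U₁ q - U₄ q) _ p :=
      (Complex.reCLM.hasFDerivAt.comp p hF).congr_of_eventuallyEq (.of_forall fun q => by simp)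
    have h23 : HasFDerivAt (fun q => U₂ q + U₃ q) _ p :=
      (Complex.imCLM.hasFDerivAt.comp p hF).congr_of_eventuallyEq (.of_forall fun q => by simp)
    have h1 : HasFDerivAt U₁ _ p := 
      (h14.fun_add h4).congr_of_eventuallyEq (.of_forall fun q => by simp)
    have h2 : HasFDerivAt U₂ _ p := 
      (h23.fun_sub h3).congr_of_eventuallyEq (.of_forall fun q => by simp)
    refine ⟨⟨h1.differentiableAt, h2.differentiableAt, h3.differentiableAt,
      h4.differentiableAt⟩, ?_⟩
    simp only [CRsys, pdx, pdy, h1.fderiv, h2.fderiv, h3.fderiv, h4.fderiv]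
    simp [complexCoord_apply]
    constructor <;> ring
  · rintro ⟨⟨h1, h2, h3, h4⟩, c1, c2, c3, c4⟩
    simp only [pdx, pdy] at c1 c2 c3 c4
    have hF := (Complex.ofRealCLM.hasFDerivAt.comp p
      (h1.hasFDerivAt.fun_sub h4.hasFDerivAt)).fun_add
      ((Complex.ofRealCLM.hasFDerivAt.comp p
        (h2.hasFDerivAt.fun_add h3.hasFDerivAt)).mul_const Complex.I)
    have hS := (Complex.ofRealCLM.hasFDerivAt.comp p h3.hasFDerivAt).fun_add
      ((Complex.ofRealCLM.hasFDerivAt.comp p h4.hasFDerivAt).mul_const Complex.I)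
    refine ⟨rep (fderiv ℝ U₁ p (1, 0)) (fderiv ℝ U₂ p (1, 0)) (fderiv ℝ U₃ p (1, 0))
      (fderiv ℝ U₄ p (1, 0)), (key p hp _).2 ⟨hF.congr_fderiv ?_, hS.congr_fderiv ?_⟩⟩
    · ext
      · simp [fst_rep, complexCoord_apply]
        ring
      · simp [fst_rep, complexCoord_apply, c1, c2, c3, c4]
        linear_combination
          (-(fderiv ℝ U₂ p (1, 0) + fderiv ℝ U₃ p (1, 0)) : ℂ) * Complex.I_sq
    · ext
      · simp [snd_rep, complexCoord_apply]
        ring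
      · simp [fst_rep, snd_rep, complexCoord_apply, c3, c4]
        linear_combination (-(fderiv ℝ U₄ p (1, 0)) : ℂ) * Complex.I_sq
end
end

section
/- Infinite smoothness of monogenic functions: let D ⊆ ℝ² be open and let U₁, U₂, U₃, U₄ : D → ℝ be (totally) differentiable in D and satisfy at every point of D the Cauchy–Riemann-type system: ∂U₁/∂y = ∂U₃/∂x; ∂U₂/∂y = ∂U₄/∂x; ∂U₃/∂y = ∂U₁/∂x − 2·∂U₄/∂x; ∂U₄/∂y = ∂U₂/∂x + 2·∂U₃/∂x. Then each U_k (k = 1,2,3,4) is infinitely differentiable in D; equivalently, the associated monogenic function Φ has derivatives of all orders in D_ζ. -/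
/- Infinite smoothness of monogenic functions: the components of a monogenic
   𝔹-valued function (differentiable solutions of the Cauchy–Riemann-type
   system) are infinitely differentiable. -/

noncomputable section

open Complex in
/-- Smoothness for the complex form of the system: `w = a + I * b` is holomorphic,
and so is `a + I * im z * deriv w`. -/
theorem contDiffOn_of_complex_system {S : Set ℂ} (hS : IsOpen S) {a b : ℂ → ℂ}
    (ha : ∀ z ∈ S, DifferentiableAt ℝ a z) (hb : ∀ z ∈ S, DifferentiableAt ℝ b z)
    (hab : ∀ z ∈ S, fderiv ℝ a z I = fderiv ℝ b z 1)
    (hba : ∀ z ∈ S, fderiv ℝ b z I = fderiv ℝ a z 1 + 2 * I * fderiv ℝ b z 1) :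
    ContDiffOn ℝ (⊤ : ℕ∞) a S ∧ ContDiffOn ℝ (⊤ : ℕ∞) b S := by
  set w : ℂ → ℂ := fun z => a z + I * b z with hw
  have hw_fderiv : ∀ z ∈ S, HasFDerivAt w (fderiv ℝ a z + I • fderiv ℝ b z) z := fun z hz =>
    (ha z hz).hasFDerivAt.add ((hb z hz).hasFDerivAt.const_mul I)
  have hw_diff : DifferentiableOn ℂ w S := fun z hz => by
    refine (differentiableAt_complex_iff_differentiableAt_real.2
      ⟨(hw_fderiv z hz).differentiableAt, ?_⟩).differentiableWithinAt
    simp only [(hw_fderiv z hz).fderiv, add_apply, smul_apply, smul_eq_mul, hab z hz, hba z hz]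
    linear_combination fderiv ℝ b z 1 * I_sq
  have hw'_diff : DifferentiableOn ℂ (deriv w) S := hw_diff.deriv hS
  have hw_deriv : ∀ z ∈ S, deriv w z = fderiv ℝ a z 1 + I * fderiv ℝ b z 1 := fun z hz => by
    have h := ((hw_diff.differentiableAt (hS.mem_nhds hz)).hasDerivAt.hasFDerivAt.restrictScalars
      ℝ).unique (hw_fderiv z hz)
    simpa using congrArg (fun L : ℂ →L[ℝ] ℂ => L 1) h
  set g : ℂ → ℂ := fun z => a z + I * ((z.im : ℂ) * deriv w z) with hg
  have hg_diff : DifferentiableOn ℂ g S := fun z hz => by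
    have him : HasFDerivAt (fun z : ℂ => (z.im : ℂ)) (ofRealCLM.comp imCLM) z :=
      (ofRealCLM.comp imCLM).hasFDerivAt
    have hg_fderiv : HasFDerivAt g _ z := (ha z hz).hasFDerivAt.add ((him.mul
      ((hw'_diff.differentiableAt (hS.mem_nhds hz)).hasDerivAt.hasFDerivAt.restrictScalars
        ℝ)).const_mul I)
    refine (differentiableAt_complex_iff_differentiableAt_real.2
      ⟨hg_fderiv.differentiableAt, ?_⟩).differentiableWithinAt
    rw [hg_fderiv.fderiv]
    simp [hab z hz, hw_deriv z hz]
    linear_combination fderiv ℝ b z 1 * I_sq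
  have hsmooth {f : ℂ → ℂ} (hf : DifferentiableOn ℂ f S) : ContDiffOn ℝ (⊤ : ℕ∞) f S :=
    (hf.contDiffOn hS).restrict_scalars ℝ
  have him_smooth : ContDiffOn ℝ (⊤ : ℕ∞) (fun z : ℂ => (z.im : ℂ)) S :=
    (ofRealCLM.comp imCLM).contDiff.contDiffOn
  have ha_smooth : ContDiffOn ℝ (⊤ : ℕ∞) a S :=
    ((hsmooth hg_diff).sub ((contDiffOn_const (c := I)).mul (him_smooth.mul (hsmooth hw'_diff)))).congr
      fun z _ => by simp [hg]
  refine ⟨ha_smooth, (contDiffOn_const.mul ((hsmooth hw_diff).sub ha_smooth)).congr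
    (f := fun z => -I * (w z - a z)) fun z _ => ?_⟩
  simp [hw, ← mul_assoc]

open Complex in
/-- The real Fréchet derivative of `u + I * v` read off along `ℂ ≃ ℝ × ℝ`. -/
theorem hasFDerivAt_ofReal_add_I_mul {u v : ℝ × ℝ → ℝ} {z : ℂ}
    (hu : DifferentiableAt ℝ u (equivRealProdCLM z))
    (hv : DifferentiableAt ℝ v (equivRealProdCLM z)) :
    HasFDerivAt (fun z => (u (equivRealProdCLM z) : ℂ) + I * v (equivRealProdCLM z))
      (ofRealCLM.comp ((fderiv ℝ u (equivRealProdCLM z)).comp (equivRealProdCLM : ℂ →L[ℝ] ℝ × ℝ)) +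
        I • ofRealCLM.comp
          ((fderiv ℝ v (equivRealProdCLM z)).comp (equivRealProdCLM : ℂ →L[ℝ] ℝ × ℝ))) z :=
  (ofRealCLM.hasFDerivAt.comp z (hu.hasFDerivAt.comp z equivRealProdCLM.hasFDerivAt)).add
    ((ofRealCLM.hasFDerivAt.comp z
      (hv.hasFDerivAt.comp z equivRealProdCLM.hasFDerivAt)).const_mul I)

open Complex in
theorem contDiffOn_re_im_of_comp_equivRealProdCLM {D : Set (ℝ × ℝ)} {u v : ℝ × ℝ → ℝ}
    (h : ContDiffOn ℝ (⊤ : ℕ∞)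
      (fun z => (u (equivRealProdCLM z) : ℂ) + I * v (equivRealProdCLM z))
      (equivRealProdCLM ⁻¹' D)) :
    ContDiffOn ℝ (⊤ : ℕ∞) u D ∧ ContDiffOn ℝ (⊤ : ℕ∞) v D := by
  have h' := h.comp equivRealProdCLM.symm.contDiff.contDiffOn (s := D) fun p hp => by
    simpa using hp
  exact ⟨(reCLM.contDiff.comp_contDiffOn h').congr fun p _ => by simp,
    (imCLM.contDiff.comp_contDiffOn h').congr fun p _ => by simp⟩

/-- If `U₁, U₂, U₃, U₄` are totally differentiable in an open set `D` and satisfy the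
Cauchy–Riemann-type system at every point of `D`, then each `U_k` is infinitely
differentiable in `D`. -/
theorem monogenic_components_smooth (D : Set (ℝ × ℝ)) (hD : IsOpen D)
    (U₁ U₂ U₃ U₄ : ℝ × ℝ → ℝ)
    (hdiff : ∀ p ∈ D, DifferentiableAt ℝ U₁ p ∧ DifferentiableAt ℝ U₂ p ∧
      DifferentiableAt ℝ U₃ p ∧ DifferentiableAt ℝ U₄ p)
    (hCR : ∀ p ∈ D, CRsys U₁ U₂ U₃ U₄ p) :
    ContDiffOn ℝ (⊤ : ℕ∞) U₁ D ∧ ContDiffOn ℝ (⊤ : ℕ∞) U₂ D ∧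
    ContDiffOn ℝ (⊤ : ℕ∞) U₃ D ∧ ContDiffOn ℝ (⊤ : ℕ∞) U₄ D := by
  have hS : IsOpen (Complex.equivRealProdCLM ⁻¹' D) :=
    hD.preimage Complex.equivRealProdCLM.continuous
  have hA : ∀ z ∈ Complex.equivRealProdCLM ⁻¹' D, _ := fun z hz =>
    hasFDerivAt_ofReal_add_I_mul (hdiff _ hz).1 (hdiff _ hz).2.1
  have hB : ∀ z ∈ Complex.equivRealProdCLM ⁻¹' D, _ := fun z hz =>
    hasFDerivAt_ofReal_add_I_mul (hdiff _ hz).2.2.1 (hdiff _ hz).2.2.2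
  obtain ⟨hA_smooth, hB_smooth⟩ := contDiffOn_of_complex_system hS
    (fun z hz => (hA z hz).differentiableAt) (fun z hz => (hB z hz).differentiableAt)
    (fun z hz => by
      obtain ⟨h1, h2, -, -⟩ := hCR _ hz
      simp only [pdx, pdy, Complex.equivRealProdCLM_apply] at h1 h2
      rw [(hA z hz).fderiv, (hB z hz).fderiv]
      simp [h1, h2])
    (fun z hz => by
      obtain ⟨-, -, h3, h4⟩ := hCR _ hz
      simp only [pdx, pdy, Complex.equivRealProdCLM_apply] at h3 h4
      rw [(hA z hz).fderiv, (hB z hz).fderiv]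
      apply Complex.ext <;> simp [h3, h4, sub_eq_add_neg])
  obtain ⟨h1, h2⟩ := contDiffOn_re_im_of_comp_equivRealProdCLM hA_smooth
  obtain ⟨h3, h4⟩ := contDiffOn_re_im_of_comp_equivRealProdCLM hB_smooth
  exact ⟨h1, h2, h3, h4⟩
end
end

section
/- Let D ⊆ ℝ² be open and let U₁, U₂, U₃, U₄ : D → ℝ be twice continuously differentiable and satisfy the Cauchy–Riemann-type system (CR) on D; let Φ = U₁e1 + U₂ie1 + U₃e2 + U₄ie2 be the associated 𝔹-valued function. Then at every point of D the componentwise Laplacian of Φ satisfies Δ₂Φ := ∂²Φ/∂x² + ∂²Φ/∂y² = (∂²Φ/∂x²) · (e1² + e2²), where e1² + e2² = 2iε in the dual numbers over ℂ. -/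
/- 𝔹 = dual numbers over ℂ, e1 = 1, e2 = i + ε.  For a monogenic function Φ
   (C² components satisfying the Cauchy–Riemann-type system), the componentwise
   Laplacian satisfies Δ₂Φ = Φ_xx · (e1² + e2²), where e1² + e2² = 2iε. -/

open TrivSqZeroExt DualNumber

noncomputable section

theorem pdx_congr {f g : ℝ × ℝ → ℝ} {p : ℝ × ℝ} (h : f =ᶠ[nhds p] g) : pdx f p = pdx g p := by
  simp only [pdx, h.fderiv_eq]

theorem pdy_congr {f g : ℝ × ℝ → ℝ} {p : ℝ × ℝ} (h : f =ᶠ[nhds p] g) : pdy f p = pdy g p := by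
  simp only [pdy, h.fderiv_eq]

theorem pdx_add_const_mul {f g : ℝ × ℝ → ℝ} {p : ℝ × ℝ} (c : ℝ) (hf : DifferentiableAt ℝ f p)
    (hg : DifferentiableAt ℝ g p) : pdx (fun q => f q + c * g q) p = pdx f p + c * pdx g p := by
  simp [pdx, fderiv_fun_add hf (hg.const_mul c), fderiv_const_mul hg]

theorem pdy_add_const_mul {f g : ℝ × ℝ → ℝ} {p : ℝ × ℝ} (c : ℝ) (hf : DifferentiableAt ℝ f p)
    (hg : DifferentiableAt ℝ g p) : pdy (fun q => f q + c * g q) p = pdy f p + c * pdy g p := by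
  simp [pdy, fderiv_fun_add hf (hg.const_mul c), fderiv_const_mul hg]

theorem differentiableAt_fderiv_of_contDiffAt_two {f : ℝ × ℝ → ℝ} {p : ℝ × ℝ}
    (h : ContDiffAt ℝ 2 f p) : DifferentiableAt ℝ (fderiv ℝ f) p :=
  (h.fderiv_right (m := 1) (by norm_num)).differentiableAt (by norm_num)

theorem differentiableAt_pdx {f : ℝ × ℝ → ℝ} {p : ℝ × ℝ} (h : ContDiffAt ℝ 2 f p) :
    DifferentiableAt ℝ (pdx f) p :=
  (differentiableAt_fderiv_of_contDiffAt_two h).clm_apply (differentiableAt_const _)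

theorem pdy_pdx {f : ℝ × ℝ → ℝ} {p : ℝ × ℝ} (h : ContDiffAt ℝ 2 f p) :
    pdy (pdx f) p = pdx (pdy f) p := by
  have hd := differentiableAt_fderiv_of_contDiffAt_two h
  have hs := h.isSymmSndFDerivAt (by simp)
  have key (v w : ℝ × ℝ) :
      fderiv ℝ (fun q => fderiv ℝ f q v) p w = fderiv ℝ (fderiv ℝ f) p w v := by
    rw [fderiv_clm_apply hd (differentiableAt_const v)]
    simp
  change fderiv ℝ (fun q => fderiv ℝ f q (1, 0)) p (0, 1)
    = fderiv ℝ (fun q => fderiv ℝ f q (0, 1)) p (1, 0)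
  rw [key, key]
  exact hs _ _

theorem one_sq_add_e₂_sq :
    (1 : DualNumber ℂ) ^ 2 + e₂ ^ 2 = inl (2 * Complex.I) * eps := by
  ext <;> simp [e₂, pow_two]
  ring

/-- The sum of `Φ` and `Φ · e₂²`, both written in components, is `Φ · (e₁² + e₂²)`. -/
theorem rep_add_rep (a b c d : ℝ) :
    rep a b c d
      + rep (a + (-2) * d) (b + 2 * c) (c + (-2) * (b + 2 * c)) (d + 2 * (a + (-2) * d))
      = rep a b c d * (inl (2 * Complex.I) * eps) := by
  ext
  · simp [rep, e₂]
    linear_combination (2 * a - 2 * d : ℂ) * Complex.I_sq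
  · simp [rep, e₂]
    linear_combination -(2 * c + 2 * b + 2 * d * Complex.I : ℂ) * Complex.I_sq

/-- For twice continuously differentiable components satisfying (CR) on an open set
`D`, at every point of `D` the componentwise Laplacian of
`Φ = U₁e1 + U₂ie1 + U₃e2 + U₄ie2` satisfies
`∂²Φ/∂x² + ∂²Φ/∂y² = (∂²Φ/∂x²)·(e1² + e2²)`, where `e1² + e2² = 2iε`. -/
theorem laplacian_of_monogenic (D : Set (ℝ × ℝ)) (hD : IsOpen D)
    (U₁ U₂ U₃ U₄ : ℝ × ℝ → ℝ)
    (h₁ : ContDiffOn ℝ 2 U₁ D) (h₂ : ContDiffOn ℝ 2 U₂ D)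
    (h₃ : ContDiffOn ℝ 2 U₃ D) (h₄ : ContDiffOn ℝ 2 U₄ D)
    (hCR : ∀ p ∈ D, CRsys U₁ U₂ U₃ U₄ p) :
    (∀ p ∈ D,
      rep (pdx (pdx U₁) p) (pdx (pdx U₂) p) (pdx (pdx U₃) p) (pdx (pdx U₄) p)
        + rep (pdy (pdy U₁) p) (pdy (pdy U₂) p) (pdy (pdy U₃) p) (pdy (pdy U₄) p)
      = rep (pdx (pdx U₁) p) (pdx (pdx U₂) p) (pdx (pdx U₃) p) (pdx (pdx U₄) p)
          * ((1 : DualNumber ℂ) ^ 2 + e₂ ^ 2)) ∧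
    (1 : DualNumber ℂ) ^ 2 + e₂ ^ 2 = inl (2 * Complex.I) * eps := by
  refine ⟨fun p hp => ?_, one_sq_add_e₂_sq⟩
  have hD' : D ∈ nhds p := hD.mem_nhds hp
  have c₁ := h₁.contDiffAt hD'
  have c₂ := h₂.contDiffAt hD'
  have c₃ := h₃.contDiffAt hD'
  have c₄ := h₄.contDiffAt hD'
  have e₁ : pdy U₁ =ᶠ[nhds p] pdx U₃ := by
    filter_upwards [hD'] with q hq using (hCR q hq).1
  have e₂' : pdy U₂ =ᶠ[nhds p] pdx U₄ := by
    filter_upwards [hD'] with q hq using (hCR q hq).2.1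
  have e₃ : pdy U₃ =ᶠ[nhds p] fun q => pdx U₁ q + (-2) * pdx U₄ q := by
    filter_upwards [hD'] with q hq
    rw [(hCR q hq).2.2.1]
    ring
  have e₄ : pdy U₄ =ᶠ[nhds p] fun q => pdx U₂ q + 2 * pdx U₃ q := by
    filter_upwards [hD'] with q hq using (hCR q hq).2.2.2
  have y₁ : pdy (pdy U₁) p = pdx (pdx U₁) p + (-2) * pdx (pdx U₄) p := by
    rw [pdy_congr e₁, pdy_pdx c₃, pdx_congr e₃,
      pdx_add_const_mul _ (differentiableAt_pdx c₁) (differentiableAt_pdx c₄)]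
  have y₂ : pdy (pdy U₂) p = pdx (pdx U₂) p + 2 * pdx (pdx U₃) p := by
    rw [pdy_congr e₂', pdy_pdx c₄, pdx_congr e₄,
      pdx_add_const_mul _ (differentiableAt_pdx c₂) (differentiableAt_pdx c₃)]
  have y₃ : pdy (pdy U₃) p
      = pdx (pdx U₃) p + (-2) * (pdx (pdx U₂) p + 2 * pdx (pdx U₃) p) := by
    rw [pdy_congr e₃, pdy_add_const_mul _ (differentiableAt_pdx c₁) (differentiableAt_pdx c₄),
      pdy_pdx c₁, pdy_pdx c₄, pdx_congr e₁, pdx_congr e₄,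
      pdx_add_const_mul _ (differentiableAt_pdx c₂) (differentiableAt_pdx c₃)]
  have y₄ : pdy (pdy U₄) p
      = pdx (pdx U₄) p + 2 * (pdx (pdx U₁) p + (-2) * pdx (pdx U₄) p) := by
    rw [pdy_congr e₄, pdy_add_const_mul _ (differentiableAt_pdx c₂) (differentiableAt_pdx c₃),
      pdy_pdx c₂, pdy_pdx c₃, pdx_congr e₂', pdx_congr e₃,
      pdx_add_const_mul _ (differentiableAt_pdx c₁) (differentiableAt_pdx c₄)]
  rw [y₁, y₂, y₃, y₄, one_sq_add_e₂_sq]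
  generalize pdx (pdx U₁) p = a
  generalize pdx (pdx U₂) p = b
  generalize pdx (pdx U₃) p = c
  generalize pdx (pdx U₄) p = d
  exact rep_add_rep a b c d
end
end

section
/- Biharmonicity of the components of a monogenic function: let D ⊆ ℝ² be open and let U₁, U₂, U₃, U₄ : D → ℝ be four times continuously differentiable and satisfy the Cauchy–Riemann-type system (CR) on D. Then each U_k (k = 1,2,3,4) is a biharmonic function in D, i.e. ∂⁴U_k/∂x⁴ + 2·∂⁴U_k/∂x²∂y² + ∂⁴U_k/∂y⁴ = 0 at every point of D. -/
/- Biharmonicity of the components of a monogenic function: C⁴ solutions of the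
   Cauchy–Riemann-type system satisfy the two-dimensional biharmonic equation. -/

noncomputable section

/-- `U` is biharmonic at `p`: `U_xxxx + 2·U_xxyy + U_yyyy = 0`. -/
def BiharmonicAt (U : ℝ × ℝ → ℝ) (p : ℝ × ℝ) : Prop :=
  pdx (pdx (pdx (pdx U))) p + 2 * pdx (pdx (pdy (pdy U))) p
    + pdy (pdy (pdy (pdy U))) p = 0

section PartialDerivatives

variable {D : Set (ℝ × ℝ)} {f g h : ℝ × ℝ → ℝ}

theorem ContDiffOn.fderiv_apply_const {m n : ℕ} (hf : ContDiffOn ℝ n f D) (hD : IsOpen D)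
    (hmn : m + 1 ≤ n) (v : ℝ × ℝ) : ContDiffOn ℝ m (fun p => fderiv ℝ f p v) D :=
  (hf.fderiv_of_isOpen hD (by exact_mod_cast hmn)).clm_apply contDiffOn_const

theorem ContDiffOn.pdx {m n : ℕ} (hf : ContDiffOn ℝ n f D) (hD : IsOpen D)
    (hmn : m + 1 ≤ n) : ContDiffOn ℝ m (pdx f) D :=
  hf.fderiv_apply_const hD hmn _

theorem ContDiffOn.pdy {m n : ℕ} (hf : ContDiffOn ℝ n f D) (hD : IsOpen D)
    (hmn : m + 1 ≤ n) : ContDiffOn ℝ m (pdy f) D :=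
  hf.fderiv_apply_const hD hmn _

theorem fderiv_eq_of_eqOn_linear_combination (hD : IsOpen D) (hf : ContDiffOn ℝ (1 : ℕ) f D)
    (hg : ContDiffOn ℝ (1 : ℕ) g D) {a b : ℝ} (hh : ∀ p ∈ D, h p = a * f p + b * g p)
    {p : ℝ × ℝ} (hp : p ∈ D) : fderiv ℝ h p = a • fderiv ℝ f p + b • fderiv ℝ g p := by
  have hDp := hD.mem_nhds hp
  have hf' := (hf.contDiffAt hDp).differentiableAt (by norm_num)
  have hg' := (hg.contDiffAt hDp).differentiableAt (by norm_num)
  have he : h =ᶠ[nhds p] fun q => a * f q + b * g q := Filter.eventually_of_mem hDp hh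
  rw [he.fderiv_eq]
  exact ((hf'.hasFDerivAt.const_mul a).add (hg'.hasFDerivAt.const_mul b)).fderiv

theorem pdx_eq_of_eqOn (hD : IsOpen D) (hf : ContDiffOn ℝ (1 : ℕ) f D)
    (hg : ContDiffOn ℝ (1 : ℕ) g D) {a b : ℝ} (hh : ∀ p ∈ D, h p = a * f p + b * g p) :
    ∀ p ∈ D, pdx h p = a * pdx f p + b * pdx g p := fun p hp => by
  simp [pdx, fderiv_eq_of_eqOn_linear_combination hD hf hg hh hp]

theorem pdy_eq_of_eqOn (hD : IsOpen D) (hf : ContDiffOn ℝ (1 : ℕ) f D)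
    (hg : ContDiffOn ℝ (1 : ℕ) g D) {a b : ℝ} (hh : ∀ p ∈ D, h p = a * f p + b * g p) :
    ∀ p ∈ D, pdy h p = a * pdy f p + b * pdy g p := fun p hp => by
  simp [pdy, fderiv_eq_of_eqOn_linear_combination hD hf hg hh hp]

theorem pdx_congr_s7 (hD : IsOpen D) (hfg : Set.EqOn f g D) : Set.EqOn (pdx f) (pdx g) D :=
  fun p hp => by
    simp only [pdx, (Filter.eventuallyEq_of_mem (hD.mem_nhds hp) hfg).fderiv_eq]

theorem pdy_congr_s7 (hD : IsOpen D) (hfg : Set.EqOn f g D) : Set.EqOn (pdy f) (pdy g) D :=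
  fun p hp => by
    simp only [pdy, (Filter.eventuallyEq_of_mem (hD.mem_nhds hp) hfg).fderiv_eq]

theorem pdy_pdx_eqOn (hD : IsOpen D) (hf : ContDiffOn ℝ (2 : ℕ) f D) :
    Set.EqOn (pdy (pdx f)) (pdx (pdy f)) D := fun p hp => by
  have hDp := hD.mem_nhds hp
  have hs : IsSymmSndFDerivAt ℝ f p := (hf.contDiffAt hDp).isSymmSndFDerivAt (by simp)
  have hd : DifferentiableAt ℝ (fderiv ℝ f) p :=
    ((hf.contDiffAt hDp).fderiv_right (m := 1) (by norm_num)).differentiableAt (by norm_num)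
  have key (v w : ℝ × ℝ) :
      fderiv ℝ (fun q => fderiv ℝ f q v) p w = fderiv ℝ (fderiv ℝ f) p w v := by
    rw [fderiv_clm_apply hd (differentiableAt_const v)]
    simp
  change fderiv ℝ (fun q => fderiv ℝ f q (1, 0)) p (0, 1) =
    fderiv ℝ (fun q => fderiv ℝ f q (0, 1)) p (1, 0)
  rw [key, key, hs.eq]

theorem pdy_pdy_pdx_pdx_eqOn (hD : IsOpen D) (hf : ContDiffOn ℝ (4 : ℕ) f D) :
    Set.EqOn (pdy (pdy (pdx (pdx f)))) (pdx (pdx (pdy (pdy f)))) D := by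
  have hx : ContDiffOn ℝ (2 : ℕ) (pdx f) D := hf.pdx hD (by norm_num)
  have hy : ContDiffOn ℝ (3 : ℕ) (pdy f) D := hf.pdy hD (by norm_num)
  have hxy := pdy_pdx_eqOn hD (hf.of_le (by norm_num))
  have hyx : ContDiffOn ℝ (2 : ℕ) (pdx (pdy f)) D := hy.pdx hD (by norm_num)
  have hyxx : Set.EqOn (pdy (pdx (pdx f))) (pdx (pdx (pdy f))) D :=
    (pdy_pdx_eqOn hD hx).trans (pdx_congr_s7 hD hxy)
  exact ((pdy_congr_s7 hD hyxx).trans (pdy_pdx_eqOn hD hyx)).trans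
    (pdx_congr_s7 hD (pdy_pdx_eqOn hD (hy.of_le (by norm_num))))

/-- A pair of `C⁴` functions whose second `y`-derivatives are linear combinations of their
second `x`-derivatives has a biharmonic first component as soon as the first row of `(A + 1)²` vanishes, where
`A = !![a, b; c, d]` is the coefficient matrix. -/
theorem biharmonicAt_of_pdy_pdy_eq (hD : IsOpen D) (hf : ContDiffOn ℝ (4 : ℕ) f D)
    (hg : ContDiffOn ℝ (4 : ℕ) g D) {a b c d : ℝ}
    (hfy : ∀ p ∈ D, pdy (pdy f) p = a * pdx (pdx f) p + b * pdx (pdx g) p)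
    (hgy : ∀ p ∈ D, pdy (pdy g) p = c * pdx (pdx f) p + d * pdx (pdx g) p)
    (h₁ : (a + 1) ^ 2 + b * c = 0) (h₂ : b * (a + d + 2) = 0) :
    ∀ p ∈ D, BiharmonicAt f p := by
  intro p hp
  have hfx : ContDiffOn ℝ (3 : ℕ) (pdx f) D := hf.pdx hD (by norm_num)
  have hgx : ContDiffOn ℝ (3 : ℕ) (pdx g) D := hg.pdx hD (by norm_num)
  have hfxx : ContDiffOn ℝ (2 : ℕ) (pdx (pdx f)) D := hfx.pdx hD (by norm_num)
  have hgxx : ContDiffOn ℝ (2 : ℕ) (pdx (pdx g)) D := hgx.pdx hD (by norm_num)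
  have hfxx₁ : ContDiffOn ℝ (1 : ℕ) (pdx (pdx f)) D := hfxx.of_le (by norm_num)
  have hgxx₁ : ContDiffOn ℝ (1 : ℕ) (pdx (pdx g)) D := hgxx.of_le (by norm_num)
  have hfyxx := pdx_eq_of_eqOn hD (hfxx.pdx hD (by norm_num)) (hgxx.pdx hD (by norm_num))
    (pdx_eq_of_eqOn hD hfxx₁ hgxx₁ hfy) p hp
  have hgyxx := pdx_eq_of_eqOn hD (hfxx.pdx hD (by norm_num)) (hgxx.pdx hD (by norm_num))
    (pdx_eq_of_eqOn hD hfxx₁ hgxx₁ hgy) p hp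
  have hfyyy := pdy_eq_of_eqOn hD (hfxx.pdy hD (by norm_num)) (hgxx.pdy hD (by norm_num))
    (pdy_eq_of_eqOn hD hfxx₁ hgxx₁ hfy) p hp
  rw [pdy_pdy_pdx_pdx_eqOn hD hf hp, pdy_pdy_pdx_pdx_eqOn hD hg hp] at hfyyy
  rw [BiharmonicAt, hfyyy, hgyxx, hfyxx]
  linear_combination pdx (pdx (pdx (pdx f))) p * h₁ + pdx (pdx (pdx (pdx g))) p * h₂

/-- If `f_y = a g_x + b h_x`, then `f_yy = a (g_y)_x + b (h_y)_x`. -/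
theorem pdy_pdy_eq_of_pdy_eq (hD : IsOpen D) (hg : ContDiffOn ℝ (2 : ℕ) g D)
    (hh : ContDiffOn ℝ (2 : ℕ) h D) {a b : ℝ}
    (hfy : ∀ p ∈ D, pdy f p = a * pdx g p + b * pdx h p) :
    ∀ p ∈ D, pdy (pdy f) p = a * pdx (pdy g) p + b * pdx (pdy h) p := by
  intro p hp
  rw [pdy_eq_of_eqOn hD (hg.pdx hD (by norm_num)) (hh.pdx hD (by norm_num)) hfy p hp,
    pdy_pdx_eqOn hD hg hp, pdy_pdx_eqOn hD hh hp]

end PartialDerivatives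

/-- If `U₁, U₂, U₃, U₄` are four times continuously differentiable on an open set `D`
and satisfy the Cauchy–Riemann-type system on `D`, then each `U_k` is a biharmonic
function in `D`. -/
theorem monogenic_components_biharmonic (D : Set (ℝ × ℝ)) (hD : IsOpen D)
    (U₁ U₂ U₃ U₄ : ℝ × ℝ → ℝ)
    (h₁ : ContDiffOn ℝ 4 U₁ D) (h₂ : ContDiffOn ℝ 4 U₂ D)
    (h₃ : ContDiffOn ℝ 4 U₃ D) (h₄ : ContDiffOn ℝ 4 U₄ D)
    (hCR : ∀ p ∈ D, CRsys U₁ U₂ U₃ U₄ p) :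
    ∀ p ∈ D, BiharmonicAt U₁ p ∧ BiharmonicAt U₂ p ∧
      BiharmonicAt U₃ p ∧ BiharmonicAt U₄ p := by
  have hC (U : ℝ × ℝ → ℝ) (hU : ContDiffOn ℝ 4 U D) : ContDiffOn ℝ (2 : ℕ) U D :=
    hU.of_le (by norm_num)
  have hX (U : ℝ × ℝ → ℝ) (hU : ContDiffOn ℝ 4 U D) : ContDiffOn ℝ (1 : ℕ) (pdx U) D :=
    (hC U hU).pdx hD (by norm_num)
  have e₁ : ∀ p ∈ D, pdy U₁ p = 1 * pdx U₃ p + 0 * pdx U₃ p := fun p hp => by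
    linear_combination (hCR p hp).1
  have e₂ : ∀ p ∈ D, pdy U₂ p = 1 * pdx U₄ p + 0 * pdx U₄ p := fun p hp => by
    linear_combination (hCR p hp).2.1
  have e₃ : ∀ p ∈ D, pdy U₃ p = 1 * pdx U₁ p + (-2) * pdx U₄ p := fun p hp => by
    linear_combination (hCR p hp).2.2.1
  have e₄ : ∀ p ∈ D, pdy U₄ p = 1 * pdx U₂ p + 2 * pdx U₃ p := fun p hp => by
    linear_combination (hCR p hp).2.2.2
  have x₁ := pdx_eq_of_eqOn hD (hX U₃ h₃) (hX U₃ h₃) e₁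
  have x₂ := pdx_eq_of_eqOn hD (hX U₄ h₄) (hX U₄ h₄) e₂
  have x₃ := pdx_eq_of_eqOn hD (hX U₁ h₁) (hX U₄ h₄) e₃
  have x₄ := pdx_eq_of_eqOn hD (hX U₂ h₂) (hX U₃ h₃) e₄
  have y₁ : ∀ p ∈ D, pdy (pdy U₁) p = 1 * pdx (pdx U₁) p + (-2) * pdx (pdx U₄) p :=
    fun p hp => by
      linear_combination pdy_pdy_eq_of_pdy_eq hD (hC U₃ h₃) (hC U₃ h₃) e₁ p hp + x₃ p hp
  have y₂ : ∀ p ∈ D, pdy (pdy U₂) p = 1 * pdx (pdx U₂) p + 2 * pdx (pdx U₃) p :=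
    fun p hp => by
      linear_combination pdy_pdy_eq_of_pdy_eq hD (hC U₄ h₄) (hC U₄ h₄) e₂ p hp + x₄ p hp
  have y₃ : ∀ p ∈ D, pdy (pdy U₃) p = (-3) * pdx (pdx U₃) p + (-2) * pdx (pdx U₂) p :=
    fun p hp => by
      linear_combination pdy_pdy_eq_of_pdy_eq hD (hC U₁ h₁) (hC U₄ h₄) e₃ p hp + x₁ p hp
        - 2 * x₄ p hp
  have y₄ : ∀ p ∈ D, pdy (pdy U₄) p = (-3) * pdx (pdx U₄) p + 2 * pdx (pdx U₁) p :=
    fun p hp => by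
      linear_combination pdy_pdy_eq_of_pdy_eq hD (hC U₂ h₂) (hC U₃ h₃) e₄ p hp + x₂ p hp
        + 2 * x₃ p hp
  have swap {u v w : ℝ × ℝ → ℝ} {a b : ℝ} (H : ∀ p ∈ D, w p = a * u p + b * v p) :
      ∀ p ∈ D, w p = b * v p + a * u p := fun p hp => (H p hp).trans (add_comm _ _)
  exact fun p hp =>
    ⟨biharmonicAt_of_pdy_pdy_eq hD h₁ h₄ y₁ (swap y₄) (by norm_num) (by norm_num) p hp,
      biharmonicAt_of_pdy_pdy_eq hD h₂ h₃ y₂ (swap y₃) (by norm_num) (by norm_num) p hp,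
      biharmonicAt_of_pdy_pdy_eq hD h₃ h₂ y₃ (swap y₂) (by norm_num) (by norm_num) p hp,
      biharmonicAt_of_pdy_pdy_eq hD h₄ h₁ y₄ (swap y₁) (by norm_num) (by norm_num) p hp⟩
end
end

section
/- Core of Theorem 3 (uniqueness for the homogeneous problem): let D ⊂ ℝ² be a bounded open set and let W : D → ℝ be four times continuously differentiable in D with ∂⁴W/∂x⁴ + 2·∂⁴W/∂x²∂y² + ∂⁴W/∂y⁴ = 0 in D. Suppose the functions ∂²W/∂x², ∂²W/∂y² extend continuously to the closure of D and their boundary limits vanish at every point of ∂D. Then ∂²W/∂x² = 0 and ∂²W/∂y² = 0 at every point of D. -/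
/- Core of Theorem 3: a biharmonic function on a bounded domain whose second pure
   derivatives extend continuously to the closure with vanishing boundary limits
   has vanishing second pure derivatives. -/

open Filter Topology

noncomputable section

/-- The derivative of `f` in the fixed direction `v`. -/
def dirDeriv (v : ℝ × ℝ) (f : ℝ × ℝ → ℝ) : ℝ × ℝ → ℝ := fun p => fderiv ℝ f p v

section Helpers

variable {D : Set (ℝ × ℝ)} {f g : ℝ × ℝ → ℝ} {v w : ℝ × ℝ}

lemma contDiffOn_dirDeriv (hD : IsOpen D) {m n : WithTop ℕ∞} (hf : ContDiffOn ℝ n f D)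
    (hmn : m + 1 ≤ n) : ContDiffOn ℝ m (dirDeriv v f) D :=
  (hf.fderiv_of_isOpen hD hmn).clm_apply contDiffOn_const

lemma eqOn_dirDeriv (hD : IsOpen D) (h : Set.EqOn f g D) :
    Set.EqOn (dirDeriv v f) (dirDeriv v g) D := fun p hp => by
  have : f =ᶠ[𝓝 p] g := by
    filter_upwards [hD.mem_nhds hp] with q hq using h hq
  simp only [dirDeriv, this.fderiv_eq]

lemma eqOn_dirDeriv_add (hD : IsOpen D) (hf : DifferentiableOn ℝ f D)
    (hg : DifferentiableOn ℝ g D) :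
    Set.EqOn (dirDeriv v (f + g)) (dirDeriv v f + dirDeriv v g) D := fun p hp => by
  have hf' := hf.differentiableAt (hD.mem_nhds hp)
  have hg' := hg.differentiableAt (hD.mem_nhds hp)
  simp [dirDeriv, fderiv_add hf' hg']

lemma dirDeriv_neg : dirDeriv v (-f) = -dirDeriv v f := by
  ext p
  simp [dirDeriv, fderiv_neg]

lemma eqOn_dirDeriv_dirDeriv_add (hD : IsOpen D) (hf : ContDiffOn ℝ 2 f D)
    (hg : ContDiffOn ℝ 2 g D) :
    Set.EqOn (dirDeriv v (dirDeriv v (f + g)))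
      (dirDeriv v (dirDeriv v f) + dirDeriv v (dirDeriv v g)) D := by
  have h1 := eqOn_dirDeriv_add (v := v) hD (hf.differentiableOn (by norm_num))
    (hg.differentiableOn (by norm_num))
  have hf' : ContDiffOn ℝ 1 (dirDeriv v f) D := contDiffOn_dirDeriv hD hf (by norm_num)
  have hg' : ContDiffOn ℝ 1 (dirDeriv v g) D := contDiffOn_dirDeriv hD hg (by norm_num)
  exact (eqOn_dirDeriv hD h1).trans (eqOn_dirDeriv_add hD
    (hf'.differentiableOn (by norm_num)) (hg'.differentiableOn (by norm_num)))

/-- Directional derivatives of a `C²` function commute. -/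
lemma eqOn_dirDeriv_comm (hD : IsOpen D) (hf : ContDiffOn ℝ 2 f D) :
    Set.EqOn (dirDeriv v (dirDeriv w f)) (dirDeriv w (dirDeriv v f)) D := fun p hp => by
  have hfp := hf.contDiffAt (hD.mem_nhds hp)
  have hd : DifferentiableAt ℝ (fderiv ℝ f) p :=
    (hfp.fderiv_right (m := 1) (by norm_num)).differentiableAt (by norm_num)
  have key (a b : ℝ × ℝ) : dirDeriv a (dirDeriv b f) p = fderiv ℝ (fderiv ℝ f) p a b := by
    unfold dirDeriv
    rw [fderiv_clm_apply hd (differentiableAt_const b)]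
    simp
  rw [key, key]
  exact hfp.isSymmSndFDerivAt (by simp) v w

/-- Second directional derivatives in two directions can be interchanged. -/
lemma eqOn_dirDeriv_sq_comm (hD : IsOpen D) (hf : ContDiffOn ℝ 4 f D) :
    Set.EqOn (dirDeriv v (dirDeriv v (dirDeriv w (dirDeriv w f))))
      (dirDeriv w (dirDeriv w (dirDeriv v (dirDeriv v f)))) D := by
  have hw : ContDiffOn ℝ 3 (dirDeriv w f) D := contDiffOn_dirDeriv hD hf (by norm_num)
  have hv : ContDiffOn ℝ 3 (dirDeriv v f) D := contDiffOn_dirDeriv hD hf (by norm_num)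
  have hwv : ContDiffOn ℝ 2 (dirDeriv w (dirDeriv v f)) D :=
    contDiffOn_dirDeriv hD hv (by norm_num)
  have h : Set.EqOn (dirDeriv v (dirDeriv w (dirDeriv w f)))
      (dirDeriv w (dirDeriv w (dirDeriv v f))) D :=
    (eqOn_dirDeriv_comm hD (hw.of_le (by norm_num))).trans
      (eqOn_dirDeriv hD (eqOn_dirDeriv_comm hD (hf.of_le (by norm_num))))
  exact ((eqOn_dirDeriv hD h).trans (eqOn_dirDeriv_comm hD hwv)).trans
    (eqOn_dirDeriv hD (eqOn_dirDeriv_comm hD (hv.of_le (by norm_num))))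

/-- The necessary second-order condition at a local maximum on the line. -/
lemma deriv_deriv_nonpos_of_isLocalMax {φ : ℝ → ℝ} {a : ℝ} (h : IsLocalMax φ a)
    (hc : ContinuousAt φ a) : deriv (deriv φ) a ≤ 0 := by
  by_contra! hpos
  have hmin := isLocalMin_of_deriv_deriv_pos hpos h.deriv_eq_zero hc
  have hconst : φ =ᶠ[𝓝 a] fun _ => φ a := by
    filter_upwards [h, hmin] with t h1 h2 using le_antisymm h1 h2
  have : deriv (deriv φ) a = 0 := by
    rw [hconst.deriv.deriv_eq]
    simp
  exact hpos.ne' this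

/-- The necessary second-order condition at a local maximum, in a fixed direction. -/
lemma dirDeriv_dirDeriv_nonpos_of_isLocalMax (hD : IsOpen D) (hf : ContDiffOn ℝ 2 f D)
    {q : ℝ × ℝ} (hq : q ∈ D) (hmax : IsLocalMax f q) : dirDeriv v (dirDeriv v f) q ≤ 0 := by
  set l : ℝ → ℝ × ℝ := fun t => q + t • v with hl
  have hl0 : l 0 = q := by simp [hl]
  have hlc : Continuous l := by fun_prop
  have hslice {h : ℝ × ℝ → ℝ} {t : ℝ} (hh : DifferentiableAt ℝ h (l t)) :
      deriv (h ∘ l) t = dirDeriv v h (l t) := by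
    have hlt : HasDerivAt l v t := by
      have h := ((hasDerivAt_id t).smul_const v).const_add q
      rw [one_smul] at h
      exact h
    exact (hh.hasFDerivAt.comp_hasDerivAt t hlt).deriv
  have hlim : Tendsto l (𝓝 0) (𝓝 q) := hl0 ▸ hlc.tendsto 0
  have hdiff {h : ℝ × ℝ → ℝ} (hh : ContDiffOn ℝ 1 h D) {z : ℝ × ℝ} (hz : z ∈ D) :
      DifferentiableAt ℝ h z :=
    (hh.contDiffAt (hD.mem_nhds hz)).differentiableAt (by norm_num)
  have hev : deriv (f ∘ l) =ᶠ[𝓝 0] dirDeriv v f ∘ l := by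
    filter_upwards [hlim (hD.mem_nhds hq)] with t ht
      using hslice (hdiff (hf.of_le (by norm_num)) ht)
  have hqD : l 0 ∈ D := hl0 ▸ hq
  have hloc : IsLocalMax (f ∘ l) 0 := by
    filter_upwards [hlim hmax] with t ht
    simpa [hl0] using ht
  have hcont : ContinuousAt (f ∘ l) 0 :=
    (hdiff (hf.of_le (by norm_num)) hqD).continuousAt.comp hlc.continuousAt
  have hle := deriv_deriv_nonpos_of_isLocalMax hloc hcont
  rwa [hev.deriv_eq, hslice (hdiff (contDiffOn_dirDeriv hD hf (by norm_num)) hqD), hl0] at hle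

lemma dirDeriv_dirDeriv_const_mul_fst_sq (c : ℝ) (q : ℝ × ℝ) :
    dirDeriv v (dirDeriv v fun p => c * p.1 ^ 2) q = 2 * c * v.1 ^ 2 := by
  have h1 : dirDeriv v (fun p => c * p.1 ^ 2) = fun p => 2 * c * v.1 * p.1 := by
    ext p
    have h := ((hasFDerivAt_fst (𝕜 := ℝ) (p := p)).pow 2).const_mul c
    rw [dirDeriv, h.fderiv]
    simp
    ring
  have h := (hasFDerivAt_fst (𝕜 := ℝ) (p := q)).const_mul (2 * c * v.1)
  rw [h1, dirDeriv, h.fderiv]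
  simp
  ring

/-- A function with vanishing boundary limits, extended by zero, is continuous on the closure. -/
lemma continuousOn_closure_indicator (hD : IsOpen D) (hf : ContinuousOn f D)
    (hb : ∀ z ∈ frontier D, Tendsto f (𝓝[D] z) (𝓝 0)) :
    ContinuousOn (D.indicator f) (closure D) := by
  intro z hz
  by_cases hzD : z ∈ D
  · refine ContinuousAt.continuousWithinAt ?_
    refine (hf.continuousAt (hD.mem_nhds hzD)).congr ?_
    filter_upwards [hD.mem_nhds hzD] with q hq using (Set.indicator_of_mem hq f).symm
  · have hzf : z ∈ frontier D := ⟨hz, by rwa [hD.interior_eq]⟩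
    rw [ContinuousWithinAt, Set.indicator_of_notMem hzD]
    refine Tendsto.mono_left ?_ nhdsWithin_le_nhds
    have hsplit : 𝓝 z = 𝓝[D] z ⊔ 𝓝[Dᶜ] z := by
      rw [← nhdsWithin_union, Set.union_compl_self, nhdsWithin_univ]
    rw [hsplit, tendsto_sup]
    constructor
    · refine (hb z hzf).congr' ?_
      filter_upwards [self_mem_nhdsWithin] with q hq using (Set.indicator_of_mem hq f).symm
    · refine tendsto_const_nhds.congr' ?_
      filter_upwards [self_mem_nhdsWithin] with q hq using (Set.indicator_of_notMem hq f).symm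

/-- The weak maximum principle for subharmonic functions with vanishing boundary limits. -/
lemma nonpos_of_laplacian_nonneg (hD : IsOpen D) (hbd : Bornology.IsBounded D)
    (hf : ContDiffOn ℝ 2 f D)
    (hlap : ∀ p ∈ D, 0 ≤ dirDeriv (1, 0) (dirDeriv (1, 0) f) p
      + dirDeriv (0, 1) (dirDeriv (0, 1) f) p)
    (hb : ∀ z ∈ frontier D, Tendsto f (𝓝[D] z) (𝓝 0)) {p : ℝ × ℝ} (hp : p ∈ D) : f p ≤ 0 := by
  by_contra! hpos
  have hcpt : IsCompact (closure D) := hbd.isCompact_closure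
  obtain ⟨R, hR⟩ := hcpt.exists_bound_of_continuousOn
    (f := fun p : ℝ × ℝ => p.1 ^ 2) (by fun_prop)
  have hR0 : 0 ≤ R := (norm_nonneg _).trans (hR p (subset_closure hp))
  obtain ⟨ε, hε, hεR⟩ : ∃ ε > 0, ε * R < f p := by
    refine ⟨f p / (R + 1), by positivity, ?_⟩
    rw [div_mul_eq_mul_div, div_lt_iff₀ (by positivity)]
    nlinarith
  set s : ℝ × ℝ → ℝ := fun p => ε * p.1 ^ 2 with hs
  have hs2 : ContDiff ℝ 2 s := by fun_prop
  obtain ⟨q, hq, hmax⟩ := hcpt.exists_isMaxOn ⟨p, subset_closure hp⟩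
    ((continuousOn_closure_indicator hD hf.continuousOn hb).add hs2.continuous.continuousOn)
  have hpq : D.indicator f p + s p ≤ D.indicator f q + s q := hmax (subset_closure hp)
  rw [Set.indicator_of_mem hp] at hpq
  have hsp : 0 ≤ s p := by positivity
  have hqD : q ∈ D := by
    by_contra hqD
    rw [Set.indicator_of_notMem hqD] at hpq
    have := (le_abs_self _).trans (hR q hq)
    have : s q ≤ ε * R := mul_le_mul_of_nonneg_left this hε.le
    linarith
  have hloc : IsLocalMax (f + s) q := by
    filter_upwards [hD.mem_nhds hqD] with z hz
    have h : D.indicator f z + s z ≤ D.indicator f q + s q := hmax (subset_closure hz)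
    rwa [Set.indicator_of_mem hz, Set.indicator_of_mem hqD] at h
  have hsecond (v : ℝ × ℝ) : dirDeriv v (dirDeriv v f) q + 2 * ε * v.1 ^ 2 ≤ 0 := by
    have h : dirDeriv v (dirDeriv v (f + s)) q ≤ 0 :=
      dirDeriv_dirDeriv_nonpos_of_isLocalMax hD (hf.add hs2.contDiffOn) hqD hloc
    rwa [eqOn_dirDeriv_dirDeriv_add hD hf hs2.contDiffOn hqD, Pi.add_apply, hs,
      dirDeriv_dirDeriv_const_mul_fst_sq] at h
  have hx := hsecond (1, 0)
  have hy := hsecond (0, 1)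
  have := hlap q hqD
  norm_num at hx hy
  linarith

/-- A harmonic function with vanishing boundary limits vanishes. -/
lemma eq_zero_of_laplacian_eq_zero (hD : IsOpen D) (hbd : Bornology.IsBounded D)
    (hf : ContDiffOn ℝ 2 f D)
    (hlap : ∀ p ∈ D, dirDeriv (1, 0) (dirDeriv (1, 0) f) p
      + dirDeriv (0, 1) (dirDeriv (0, 1) f) p = 0)
    (hb : ∀ z ∈ frontier D, Tendsto f (𝓝[D] z) (𝓝 0)) {p : ℝ × ℝ} (hp : p ∈ D) : f p = 0 := by
  refine le_antisymm
    (nonpos_of_laplacian_nonneg hD hbd hf (fun q hq => (hlap q hq).ge) hb hp) ?_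
  have h := nonpos_of_laplacian_nonneg hD hbd hf.neg (fun q hq => ?_)
    (fun z hz => by simpa using (hb z hz).neg) hp
  · simpa using h
  · change 0 ≤ dirDeriv _ (dirDeriv _ (-f)) q + dirDeriv _ (dirDeriv _ (-f)) q
    simp only [dirDeriv_neg, Pi.neg_apply]
    linarith [hlap q hq]

end Helpers

/-- If `W` is four times continuously differentiable and biharmonic in a bounded open
set `D ⊂ ℝ²`, and its second derivatives `∂²W/∂x²`, `∂²W/∂y²` have vanishing limits
at every boundary point of `D` (i.e. they extend continuously to the closure of `D`
with zero boundary values), then `∂²W/∂x² = 0` and `∂²W/∂y² = 0` in `D`. -/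
theorem homogeneous_second_derivatives_vanish (D : Set (ℝ × ℝ)) (hD : IsOpen D)
    (hbd : Bornology.IsBounded D)
    (W : ℝ × ℝ → ℝ) (hW : ContDiffOn ℝ 4 W D)
    (hbih : ∀ p ∈ D, pdx (pdx (pdx (pdx W))) p + 2 * pdx (pdx (pdy (pdy W))) p
      + pdy (pdy (pdy (pdy W))) p = 0)
    (hbx : ∀ z ∈ frontier D, Tendsto (pdx (pdx W)) (𝓝[D] z) (𝓝 0))
    (hby : ∀ z ∈ frontier D, Tendsto (pdy (pdy W)) (𝓝[D] z) (𝓝 0)) :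
    ∀ p ∈ D, pdx (pdx W) p = 0 ∧ pdy (pdy W) p = 0 := by
  have hW3 (v : ℝ × ℝ) : ContDiffOn ℝ 3 (dirDeriv v W) D :=
    contDiffOn_dirDeriv hD hW (by norm_num)
  have hW2 (v : ℝ × ℝ) : ContDiffOn ℝ 2 (dirDeriv v (dirDeriv v W)) D :=
    contDiffOn_dirDeriv hD (hW3 v) (by norm_num)
  have hu : ContDiffOn ℝ 2 (pdx (pdx W)) D := hW2 (1, 0)
  have hv : ContDiffOn ℝ 2 (pdy (pdy W)) D := hW2 (0, 1)
  have hcomm : Set.EqOn (pdy (pdy (pdx (pdx W)))) (pdx (pdx (pdy (pdy W)))) D :=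
    eqOn_dirDeriv_sq_comm hD hW
  have hxx : Set.EqOn (pdx (pdx (pdx (pdx W) + pdy (pdy W))))
      (pdx (pdx (pdx (pdx W))) + pdx (pdx (pdy (pdy W)))) D :=
    eqOn_dirDeriv_dirDeriv_add hD hu hv
  have hyy : Set.EqOn (pdy (pdy (pdx (pdx W) + pdy (pdy W))))
      (pdy (pdy (pdx (pdx W))) + pdy (pdy (pdy (pdy W)))) D :=
    eqOn_dirDeriv_dirDeriv_add hD hu hv
  have hsum : Set.EqOn (pdx (pdx W) + pdy (pdy W)) 0 D := fun p hp =>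
    eq_zero_of_laplacian_eq_zero hD hbd (hu.add hv)
      (fun q hq => by
        change pdx (pdx (pdx (pdx W) + pdy (pdy W))) q
          + pdy (pdy (pdx (pdx W) + pdy (pdy W))) q = 0
        rw [hxx hq, hyy hq, Pi.add_apply, Pi.add_apply, hcomm hq]
        linarith [hbih q hq])
      (fun z hz => by simpa using (hbx z hz).add (hby z hz)) hp
  have hzero : dirDeriv (1, 0) (dirDeriv (1, 0) (0 : ℝ × ℝ → ℝ)) = 0 := by
    have h : dirDeriv (1, 0) (0 : ℝ × ℝ → ℝ) = 0 := by
      ext p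
      simp [dirDeriv]
    rw [h, h]
  intro p hp
  have hup : pdx (pdx W) p = 0 :=
    eq_zero_of_laplacian_eq_zero hD hbd hu
      (fun q hq => by
        change pdx (pdx (pdx (pdx W))) q + pdy (pdy (pdx (pdx W))) q = 0
        have h : pdx (pdx (pdx (pdx W) + pdy (pdy W))) q = 0 :=
          (eqOn_dirDeriv hD (eqOn_dirDeriv hD hsum) hq).trans (congrFun hzero q)
        rwa [hxx hq, Pi.add_apply, ← hcomm hq] at h)
      hbx hp
  have h : pdx (pdx W) p + pdy (pdy W) p = 0 := hsum hp
  exact ⟨hup, by linarith⟩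
end
end
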